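/- Suppose β ≠ 0, A ≠ 0 and ω ≠ 0. Let (x_1,…,x_N,y_1,…,y_N) : ℝ → ℝ^{2N} be differentiable functions solving the network equations for all t ∈ ℝ. If for some indices i and j one has x_i(t) = x_j(t) for every t ∈ ℝ, then μ_i = μ_j. (Equivalently: two oscillators of the periodically forced heterogeneous network cannot be exactly synchronised, x_i(t) = x_j(t) for all t, unless their heterogeneity parameters coincide.) -/

import Mathlib

namespace VanDerPolNetwork

open Polynomial

section OneVariable

variable {F : Type*} [Field F]

lemma X_sub_one_mul_derivative_pow (c : F) (b : ℕ) :
    (X - C c) * derivative ((X - C c) ^ b) = C (b : F) * (X - C c) ^ b := by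
  cases b with
  | zero => simp
  | succ b => rw [derivative_pow_succ]; simp; ring

lemma derivative_one_sub_X_cube : derivative (1 - X ^ 3 : F[X]) = -(3 * X ^ 2) := by
  rw [derivative_sub, derivative_one, derivative_X_pow, Nat.cast_ofNat, C_ofNat]; simp

lemma one_sub_X_cube_mul_derivative_pow (a : ℕ) :
    (1 - X ^ 3 : F[X]) * derivative ((1 - X ^ 3 : F[X]) ^ a)
      = -(3 * C (a : F) * X ^ 2 * (1 - X ^ 3) ^ a) := by
  cases a with
  | zero => simp
  | succ b => rw [derivative_pow_succ, derivative_one_sub_X_cube]; simp; ring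

/-- If `p ≠ 0` has a zero of order `b` at `c`, then `(X - c) p'` has the expansion expected of it. -/
lemma exists_factor_with_derivative (c : F) {p : F[X]} (hp : p ≠ 0) :
    ∃ (b : ℕ) (t : F[X]), t.eval c ≠ 0 ∧ p = (X - C c) ^ b * t ∧
      (X - C c) * derivative p = (X - C c) ^ b * (C (b : F) * t + (X - C c) * derivative t) := by
  obtain ⟨t, ht, hnd⟩ := exists_eq_pow_rootMultiplicity_mul_and_not_dvd p hp c
  refine ⟨_, t, fun h => hnd (dvd_iff_isRoot.mpr h), ht, ?_⟩
  generalize rootMultiplicity c p = b at ht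
  rw [ht, derivative_mul, mul_add, ← mul_assoc, X_sub_one_mul_derivative_pow]
  ring

/-- The exponent in a polynomial solution of `(1 - X³) p' = k X² p`. -/
lemma exists_exponent_of_first_order {p : F[X]} (hp : p ≠ 0) {k : F}
    (h : (1 - X ^ 3) * derivative p = C k * X ^ 2 * p) : ∃ a : ℕ, k = -(3 * a) := by
  obtain ⟨b, t, ht, hpt, hd⟩ := exists_factor_with_derivative 1 hp
  have hX : (X - C (1 : F)) ≠ 0 := X_sub_C_ne_zero 1
  have key : (X - C 1) ^ b * (-(1 + X + X ^ 2) * (C (b : F) * t + (X - C 1) * derivative t)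
      - C k * X ^ 2 * t) = 0 := by
    have hw : (1 - X ^ 3 : F[X]) = (X - C 1) * (-(1 + X + X ^ 2)) := by simp; ring
    rw [hw] at h
    linear_combination h + C k * X ^ 2 * hpt + (1 + X + X ^ 2) * hd
  have h1 := congrArg (eval 1) ((mul_eq_zero.mp key).resolve_left (pow_ne_zero b hX))
  simp at h1
  refine ⟨b, ?_⟩
  have : (k + 3 * b) * eval 1 t = 0 := by linear_combination -h1
  exact eq_neg_of_add_eq_zero_left ((mul_eq_zero.mp this).resolve_right ht)

variable [CharZero F]

lemma eval_one_eq_zero_of_first_order {p r : F[X]} {a : ℕ}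
    (h : (1 - X ^ 3) * derivative p + 3 * C (a : F) * X ^ 2 * p = (1 - X ^ 3) ^ a * r) :
    r.eval 1 = 0 := by
  have hw : (1 - X ^ 3 : F[X]) = (X - C 1) * (-(1 + X + X ^ 2)) := by simp; ring
  have h3 : (-(1 + 1 + 1) : F) ≠ 0 := by norm_num
  by_cases hp : p = 0
  · subst hp
    have h0 : (1 - X ^ 3 : F[X]) ^ a * r = 0 := by simpa using h.symm
    have : (1 - X ^ 3 : F[X]) ^ a ≠ 0 := by
      intro h1
      have := congrArg (eval 0) h1
      simp at this
    rcases mul_eq_zero.mp h0 with h1 | h1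
    · exact absurd h1 this
    · simp [h1]
  obtain ⟨b, t, ht, hpt, hd⟩ := exists_factor_with_derivative 1 hp
  have hX : (X - C (1 : F)) ≠ 0 := X_sub_C_ne_zero 1
  set y : F[X] := X - C 1 with hy
  have hy1 : eval 1 y = 0 := by simp [hy]
  have key : y ^ b * (-(1 + X + X ^ 2) * (C (b : F) * t + y * derivative t)
      + 3 * C (a : F) * X ^ 2 * t) = y ^ a * ((-(1 + X + X ^ 2)) ^ a * r) := by
    rw [hw, mul_pow] at h
    linear_combination h - 3 * C (a : F) * X ^ 2 * hpt + (1 + X + X ^ 2) * hd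
  rcases lt_trichotomy b a with hba | hba | hba
  · obtain ⟨c, rfl⟩ := Nat.exists_eq_add_of_lt hba
    rw [show b + c + 1 = b + (c + 1) by ring, pow_add y, mul_assoc (y ^ b)] at key
    have := congrArg (eval 1) (mul_left_cancel₀ (pow_ne_zero b hX) key)
    simp [hy1] at this
    have h4 : ((c : F) + 1) * eval 1 t = 0 := by linear_combination this / 3
    rcases mul_eq_zero.mp h4 with h5 | h5
    · exact absurd h5 (by exact_mod_cast Nat.succ_ne_zero c)
    · exact absurd h5 ht
  · subst hba
    have := congrArg (eval 1) (mul_left_cancel₀ (pow_ne_zero b hX) key)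
    simp only [eval_add, eval_mul, eval_neg, eval_one, eval_X, eval_pow, hy1, eval_C] at this
    have h4 : (-(1 + 1 + 1) : F) ^ b * eval 1 r = 0 := by
      rw [← C_ofNat, eval_C] at this
      linear_combination -this
    exact (mul_eq_zero.mp h4).resolve_left (pow_ne_zero _ h3)
  · obtain ⟨c, rfl⟩ := Nat.exists_eq_add_of_lt hba
    rw [show a + c + 1 = a + (c + 1) by ring, pow_add y, mul_assoc (y ^ a)] at key
    have := congrArg (eval 1) (mul_left_cancel₀ (pow_ne_zero a hX) key)
    simp only [eval_mul, eval_pow, hy1, eval_neg, eval_add, eval_one, eval_X] at this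
    have h4 : (-(1 + 1 + 1) : F) ^ a * eval 1 r = 0 := by simpa using this.symm
    exact (mul_eq_zero.mp h4).resolve_left (pow_ne_zero _ h3)

lemma eq_C_mul_of_first_order {p : F[X]} {a : ℕ}
    (h : (1 - X ^ 3) * derivative p + 3 * C (a : F) * X ^ 2 * p = 0) :
    p = C (p.coeff 0) * (1 - X ^ 3) ^ a := by
  by_contra hne
  set q : F[X] := p - C (p.coeff 0) * (1 - X ^ 3) ^ a with hq
  have hq0 : q ≠ 0 := sub_ne_zero.mpr hne
  have hqc : q.eval 0 = 0 := by simp [hq, coeff_zero_eq_eval_zero]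
  have hT : (1 - X ^ 3) * derivative q + 3 * C (a : F) * X ^ 2 * q = 0 := by
    rw [hq, derivative_sub, derivative_C_mul]
    linear_combination h - C (p.coeff 0) * one_sub_X_cube_mul_derivative_pow (F := F) a
  obtain ⟨b, t, ht, hqt, hd⟩ := exists_factor_with_derivative 0 hq0
  have key : (X - C 0) ^ b * ((1 - X ^ 3) * (C (b : F) * t + (X - C 0) * derivative t)
      + 3 * C (a : F) * X ^ 2 * (X - C 0) * t) = 0 := by
    linear_combination (X - C 0) * hT - 3 * C (a : F) * X ^ 2 * (X - C 0) * hqt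
      - (1 - X ^ 3) * hd
  have h1 := congrArg (eval 0)
    ((mul_eq_zero.mp key).resolve_left (pow_ne_zero b (X_sub_C_ne_zero 0)))
  simp at h1
  rcases h1 with h1 | h1
  · subst h1
    rw [hqt] at hqc
    simp at hqc
    exact ht hqc
  · exact ht h1

end OneVariable

lemma natDegree_one_sub_X_cube_pow {F : Type*} [Field F] (a : ℕ) :
    ((1 - X ^ 3 : F[X]) ^ a).natDegree = 3 * a := by
  have h : (1 - X ^ 3 : F[X]).natDegree = 3 := by compute_degree!
  rw [natDegree_pow, h, mul_comm]

/-- The leading quasi-homogeneous parts of a Darboux polynomial of a Liénard system with cubic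
damping force its quasi-degree `N` to vanish. -/
lemma quasi_degree_eq_zero {F : Type*} [Field F] [CharZero F] [Differential F]
    {Λ κ k0 k1 k2 : F} (hΛ : Differential.deriv Λ = 0) (hκ : κ ≠ 0) {N : ℕ}
    {p0 p1 p2 p3 p4 : F[X]} (hp0 : p0 ≠ 0) (hdeg : p0.natDegree ≤ N)
    (hc : p0.coeff 0 ≠ 0 → p2.coeff 0 = 0)
    (e0 : (1 - X ^ 3) * derivative p0 = C k2 * X ^ 2 * p0)
    (e1 : (1 - X ^ 3) * derivative p1 = C k2 * X ^ 2 * p1 + C k1 * X * p0)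
    (e2 : (1 - X ^ 3) * derivative p2 + C Λ * X * derivative p0 + Differential.mapCoeffs p0
      = C k2 * X ^ 2 * p2 + C k1 * X * p1 + C k0 * p0)
    (e4 : (1 - X ^ 3) * derivative p4 + C Λ * X * derivative p2 + Differential.mapCoeffs p2
      + C (κ / 3) * (X ^ 2 * derivative p0 - (N : F[X]) * X * p0)
      = C k2 * X ^ 2 * p4 + C k1 * X * p3 + C k0 * p2) : N = 0 := by
  obtain ⟨a, rfl⟩ := exists_exponent_of_first_order hp0 e0
  have hk : (C (-(3 * a)) : F[X]) = -(3 * C (a : F)) := by simp [map_ofNat]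
  rw [hk] at e0 e1 e2 e4
  have hp0' := eq_C_mul_of_first_order (p := p0) (a := a) (by linear_combination e0)
  set h := p0.coeff 0 with hh
  have hh0 : h ≠ 0 := by
    intro h0
    rw [h0] at hp0'
    exact hp0 (by simpa using hp0')
  specialize hc hh0
  have h3a : 3 * a ≤ N := by
    rw [hp0', natDegree_C_mul hh0, natDegree_one_sub_X_cube_pow] at hdeg
    exact hdeg
  have hg := one_sub_X_cube_mul_derivative_pow (F := F) a
  have hw1 : (1 - X ^ 3 : F[X]) ^ (a + 1) = (1 - X ^ 3) * (1 - X ^ 3) ^ a := by ring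
  have hw2 : (1 - X ^ 3 : F[X]) ^ (a + 2) = (1 - X ^ 3) ^ 2 * (1 - X ^ 3) ^ a := by ring
  have hDw : Differential.mapCoeffs (1 - X ^ 3 : F[X]) = 0 := by
    simp [Derivation.leibniz_pow]
  have hDg : Differential.mapCoeffs ((1 - X ^ 3 : F[X]) ^ a) = 0 := by
    rw [Derivation.leibniz_pow, hDw]; simp
  set g : F[X] := (1 - X ^ 3) ^ a with hgdef
  have hdp0 : derivative p0 = C h * derivative g := by rw [hp0', derivative_C_mul]
  have hDp0 : Differential.mapCoeffs p0 = C (Differential.deriv h) * g := by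
    rw [hp0', Derivation.leibniz, hDg]; simp [mul_comm]
  -- the coefficient `k1` vanishes
  have hk1 : k1 = 0 := by
    have := eval_one_eq_zero_of_first_order (p := p1) (r := C (k1 * h) * X) (a := a) (by
      rw [C_mul, ← hgdef]
      linear_combination e1 + C k1 * X * hp0')
    simp at this
    exact this.resolve_right hh0
  subst hk1
  have hdw : derivative (1 - X ^ 3 : F[X]) = -(3 * X ^ 2) :=
    derivative_one_sub_X_cube
  -- determination of `p2`
  have hT2 : (1 - X ^ 3) * derivative ((1 - X ^ 3) * p2 - C (a * Λ * h) * (X * g))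
      + 3 * C ((a + 1 : ℕ) : F) * X ^ 2 * ((1 - X ^ 3) * p2 - C (a * Λ * h) * (X * g))
      = (1 - X ^ 3) ^ (a + 1) * C (k0 * h - Differential.deriv h - a * Λ * h) := by
    rw [hw1, derivative_sub, derivative_mul, hdw, derivative_C_mul, derivative_mul, derivative_X]
    rw [hdp0, hDp0, hp0'] at e2
    simp only [C_mul, C_sub, Nat.cast_add, Nat.cast_one, C_add, C_1, C_0, zero_mul, add_zero] at e2 ⊢
    linear_combination (1 - X ^ 3) * e2 - (C Λ * X * C h + C (a : F) * C Λ * C h * X) * hg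
  have hk0 := eval_one_eq_zero_of_first_order hT2
  rw [eval_C] at hk0
  rw [hk0, C_0, mul_zero] at hT2
  have hp2 : (1 - X ^ 3) * p2 = C (a * Λ * h) * (X * g) := by
    have := eq_C_mul_of_first_order hT2
    have hc0 : ((1 - X ^ 3) * p2 - C (a * Λ * h) * (X * g)).coeff 0 = 0 := by
      simp [mul_coeff_zero, hc]
    rw [hc0] at this
    rw [C_0, zero_mul] at this
    exact sub_eq_zero.mp this
  have hdp2 : (1 - X ^ 3) * derivative p2 - 3 * X ^ 2 * p2
      = C (a * Λ * h) * (g + X * derivative g) := by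
    have := congrArg derivative hp2
    rw [derivative_mul, hdw, derivative_C_mul, derivative_mul, derivative_X] at this
    linear_combination this
  have hDp2 : (1 - X ^ 3) * Differential.mapCoeffs p2
      = C (a * Λ * Differential.deriv h) * (X * g) := by
    have := congrArg Differential.mapCoeffs hp2
    simp only [Derivation.leibniz, hDw, hDg, Differential.mapCoeffs_C, Differential.mapCoeffs_X,
      hΛ, smul_eq_mul, mul_zero, add_zero, zero_add, Derivation.map_natCast] at this
    rw [this]
    simp only [C_mul]
    ring
  obtain ⟨A, hA⟩ : ∃ A : F, 2 * A = a * (a - 1) * Λ ^ 2 * h :=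
    ⟨a * (a - 1) * Λ ^ 2 * h / 2, by ring⟩
  obtain ⟨K, hK⟩ : ∃ K : F, K = κ / 3 := ⟨_, rfl⟩
  rw [← hK] at e4
  have hT4 : (1 - X ^ 3) * derivative ((1 - X ^ 3) * ((1 - X ^ 3) * p4)
        - C A * (X ^ 2 * g) - C (K * h * a) * (X ^ 2 * ((1 - X ^ 3) * g)))
      + 3 * C ((a + 2 : ℕ) : F) * X ^ 2 * ((1 - X ^ 3) * ((1 - X ^ 3) * p4)
        - C A * (X ^ 2 * g) - C (K * h * a) * (X ^ 2 * ((1 - X ^ 3) * g)))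
      = (1 - X ^ 3) ^ (a + 2) * (C (K * h * (N - 2 * a)) * X) := by
    have hk0' : (C k0 * C h - C (Differential.deriv h) - C (a : F) * C Λ * C h : F[X]) = 0 := by
      rw [← C_mul, ← C_mul, ← C_mul, ← C_sub, ← C_sub, hk0, C_0]
    have hA' : (2 * C A - C (a : F) * (C (a : F) - 1) * C Λ ^ 2 * C h : F[X]) = 0 := by
      rw [sub_eq_zero, show (2 : F[X]) = C 2 from (map_ofNat C 2).symm, ← C_mul, hA]; simp
    have h2 : (C 2 : F[X]) = 2 := map_ofNat C 2
    have hN : (C (N : F) : F[X]) = (N : F[X]) := by simp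
    have hdX : derivative (X ^ 2 : F[X]) = 2 * X := by
      rw [derivative_X_pow]; simp [h2]
    rw [hw2]
    rw [hdp0, hp0'] at e4
    simp only [derivative_sub, derivative_mul, hdw, derivative_C, hdX,
      C_mul, C_sub, Nat.cast_add, C_add, hN, Nat.cast_ofNat, h2, C_0] at e4 hdp2 hDp2 hp2 ⊢
    linear_combination (1 - X ^ 3) ^ 2 * e4 + C k0 * (1 - X ^ 3) * hp2 - (1 - X ^ 3) * hDp2
      - C Λ * X * ((1 - X ^ 3) * hdp2 + 3 * X ^ 2 * hp2)
      - (C A * X ^ 2 + C K * C h * C (a : F) * X ^ 2 * (1 - X ^ 3)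
        + (1 - X ^ 3) * C K * X ^ 2 * C h + C (a : F) * C Λ ^ 2 * C h * X ^ 2) * hg
      + (1 - X ^ 3) * C (a : F) * C Λ * X * g * hk0' - g * X * (1 + 2 * X ^ 3) * hA'
  have hfin := eval_one_eq_zero_of_first_order hT4
  have hK0 : K ≠ 0 := by rw [hK]; exact div_ne_zero hκ (by norm_num)
  have hNa : (N : F) = (2 * a : ℕ) := by
    simp only [eval_mul, eval_C, eval_X, mul_one] at hfin
    push_cast
    exact sub_eq_zero.mp ((mul_eq_zero.mp hfin).resolve_left (mul_ne_zero hK0 hh0))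
  have := Nat.cast_injective hNa
  omega

section bideriv
variable {F : Type*} [Field F]

lemma bivariate_induction {motive : F[X][X] → Prop} (P : F[X][X])
    (hC : ∀ c, motive (C (C c))) (hZ : motive (C X)) (hV : motive X)
    (hadd : ∀ P Q, motive P → motive Q → motive (P + Q))
    (hmul : ∀ P Q, motive P → motive Q → motive (P * Q)) : motive P := by
  have hCp : ∀ p : F[X], motive (C p) := by
    intro p
    induction p using Polynomial.induction_on with
    | C a => exact hC a
    | add p q hp hq => rw [C_add]; exact hadd _ _ hp hq
    | monomial n a ih =>
      rw [pow_succ, ← mul_assoc, C_mul]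
      exact hmul _ _ ih hZ
  induction P using Polynomial.induction_on with
  | C a => exact hCp a
  | add p q hp hq => exact hadd _ _ hp hq
  | monomial n a ih =>
    rw [pow_succ, ← mul_assoc]
    exact hmul _ _ ih hV

lemma map_derivation_eq {B : Type*} [CommRing B] (f : F[X][X] →+* B)
    (d : Derivation ℤ F[X][X] F[X][X]) (δ : B → B) (s : B)
    (hadd : ∀ a b, δ (a + b) = δ a + δ b) (hmul : ∀ a b, δ (a * b) = a * δ b + b * δ a)
    (hC : ∀ c, δ (f (C (C c))) = s * f (d (C (C c))))
    (hZ : δ (f (C X)) = s * f (d (C X))) (hV : δ (f X) = s * f (d X)) (P : F[X][X]) :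
    δ (f P) = s * f (d P) := by
  induction P using bivariate_induction with
  | hC c => exact hC c
  | hZ => exact hZ
  | hV => exact hV
  | hadd P Q hP hQ => simp only [map_add, hadd, hP, hQ, mul_add]
  | hmul P Q hP hQ =>
    simp only [map_mul, hmul, Derivation.leibniz, hP, hQ, map_add, smul_eq_mul]
    ring

/-- The derivation on `F[X][X]` acting as `derivative` on the inner variable. -/
noncomputable def innerDerivative : Derivation ℤ F[X][X] F[X][X] :=
  letI : Differential F[X] := ⟨derivative'.restrictScalars ℤ⟩
  Differential.mapCoeffs

lemma coeff_innerDerivative (P : F[X][X]) (n : ℕ) :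
    (innerDerivative P).coeff n = derivative (P.coeff n) := rfl

variable [Differential F]

/-- The derivation on `F[X][X]` which differentiates the scalar coefficients. -/
noncomputable def scalarDerivative : Derivation ℤ F[X][X] F[X][X] :=
  letI : Differential F[X] := ⟨Differential.mapCoeffs⟩
  Differential.mapCoeffs

lemma coeff_scalarDerivative (P : F[X][X]) (n : ℕ) :
    (scalarDerivative P).coeff n = Differential.mapCoeffs (P.coeff n) := rfl

/-- The derivation `w ∂ + a ∂_outer + b ∂_inner` on `F[X][X]`, with `∂` acting on scalars. -/
noncomputable def bideriv (w a b : F[X][X]) : Derivation ℤ F[X][X] F[X][X] :=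
  w • scalarDerivative + a • derivative'.restrictScalars ℤ + b • innerDerivative

lemma bideriv_apply (w a b P : F[X][X]) :
    bideriv w a b P = w * scalarDerivative P + a * derivative P + b * innerDerivative P := rfl

lemma bideriv_C_C (w a b : F[X][X]) (c : F) :
    bideriv w a b (C (C c)) = w * C (C (Differential.deriv c)) := by
  have h1 : scalarDerivative (C (C c) : F[X][X]) = C (C (Differential.deriv c)) := by
    ext1 n; rw [coeff_scalarDerivative, coeff_C, coeff_C]; split_ifs <;> simp
  have h2 : innerDerivative (C (C c) : F[X][X]) = 0 := by
    ext1 n; rw [coeff_innerDerivative, coeff_C]; split_ifs <;> simp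
  rw [bideriv_apply, h1, h2]; simp

lemma bideriv_C_X (w a b : F[X][X]) : bideriv w a b (C X) = b := by
  have h1 : scalarDerivative (C X : F[X][X]) = 0 := by
    ext1 n; rw [coeff_scalarDerivative, coeff_C]; split_ifs <;> simp
  have h2 : innerDerivative (C X : F[X][X]) = 1 := by
    ext1 n; rw [coeff_innerDerivative, coeff_C, coeff_one]; split_ifs <;> simp
  rw [bideriv_apply, h1, h2]; simp

lemma bideriv_X (w a b : F[X][X]) : bideriv w a b X = a := by
  have h1 : scalarDerivative (X : F[X][X]) = 0 := by
    ext1 n; rw [coeff_scalarDerivative, coeff_X]; split_ifs <;> simp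
  have h2 : innerDerivative (X : F[X][X]) = 0 := by
    ext1 n; rw [coeff_innerDerivative, coeff_X]; split_ifs <;> simp
  rw [bideriv_apply, h1, h2]; simp

end bideriv

section lienard
variable {F : Type*} [Field F] [Differential F]

/-- The Liénard derivation `V' = Z - V ^ 3 + Λ V`, `Z' = ξ - κ V` on `F[X][X]`, where `V` is the
outer and `Z` the inner variable. -/
noncomputable def lienard (Λ ξ κ : F) : Derivation ℤ F[X][X] F[X][X] :=
  bideriv 1 (C X - X ^ 3 + C (C Λ) * X) (C (C ξ) - C (C κ) * X)

/-- The Liénard derivation in the weighted coordinates `V = s x`, `Z = s ^ 3`, multiplied by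
`s ^ 3`; here `s` is the outer and `x` the inner variable. -/
noncomputable def weightedLienard (Λ ξ κ : F) : Derivation ℤ F[X][X] F[X][X] :=
  bideriv (X ^ 3)
    (C (C (ξ / 3)) * X - C (C (κ / 3) * X) * X ^ 2)
    (C (1 - X ^ 3) * X ^ 5 + C (C Λ * X) * X ^ 3 - C (C (ξ / 3) * X)
      + C (C (κ / 3) * X ^ 2) * X)

/-- The substitution `V = s x`, `Z = s ^ 3`. -/
noncomputable def weightedSubst : F[X][X] →+* F[X][X] :=
  eval₂RingHom (eval₂RingHom (C.comp C) (X ^ 3)) (C X * X)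

omit [Differential F] in
lemma weightedSubst_C_C (c : F) : weightedSubst (C (C c)) = C (C c) := by simp [weightedSubst]
omit [Differential F] in
lemma weightedSubst_C_X : weightedSubst (C X : F[X][X]) = X ^ 3 := by simp [weightedSubst]
omit [Differential F] in
lemma weightedSubst_X : weightedSubst (X : F[X][X]) = C X * X := by simp [weightedSubst]

lemma weightedLienard_weightedSubst [CharZero F] (Λ ξ κ : F) (P : F[X][X]) :
    weightedLienard Λ ξ κ (weightedSubst P) = X ^ 3 * weightedSubst (lienard Λ ξ κ P) := by
  have h3 : (3 : F) ≠ 0 := by norm_num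
  have hξ : (C (C ξ) : F[X][X]) = 3 * C (C (ξ / 3)) := by
    rw [← map_ofNat (C (R := F[X])) 3, ← map_ofNat (C (R := F)) 3, ← C_mul, ← C_mul,
      mul_div_cancel₀ _ h3]
  have hκ : (C (C κ) : F[X][X]) = 3 * C (C (κ / 3)) := by
    rw [← map_ofNat (C (R := F[X])) 3, ← map_ofNat (C (R := F)) 3, ← C_mul, ← C_mul,
      mul_div_cancel₀ _ h3]
  apply map_derivation_eq _ _ _ _ (map_add _) (fun a b => by simp)
  · intro c
    rw [weightedSubst_C_C, lienard, weightedLienard, bideriv_C_C, bideriv_C_C, one_mul,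
      weightedSubst_C_C]
  · rw [weightedSubst_C_X, Derivation.leibniz_pow, lienard, weightedLienard, bideriv_C_X,
      bideriv_X, map_sub, map_mul weightedSubst, weightedSubst_C_C, weightedSubst_C_C, weightedSubst_X, hξ, hκ]
    simp only [smul_eq_mul, nsmul_eq_mul, C_mul, Nat.cast_ofNat]
    ring
  · rw [weightedSubst_X, Derivation.leibniz, lienard, weightedLienard, bideriv_X, bideriv_C_X,
      bideriv_X]
    simp only [map_sub, map_add, map_mul, map_pow, weightedSubst_C_C, weightedSubst_X,
      weightedSubst_C_X, smul_eq_mul, map_one]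
    ring

omit [Differential F] in
lemma coeff_coeff_weightedSubst (P : F[X][X]) (m j : ℕ) :
    ((weightedSubst P).coeff m).coeff j =
      if j ≤ m ∧ 3 ∣ m - j then (P.coeff j).coeff ((m - j) / 3) else 0 := by
  induction P using Polynomial.induction_on' with
  | add p q hp hq =>
    simp only [map_add, coeff_add, hp, hq]
    split_ifs <;> simp
  | monomial n p =>
    induction p using Polynomial.induction_on' with
    | add p q hp hq =>
      simp only [map_add, coeff_add, hp, hq]
      split_ifs <;> simp
    | monomial l a =>
      have : weightedSubst (monomial n (monomial l a)) = monomial (n + 3 * l) (monomial n a) := by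
        rw [← C_mul_X_pow_eq_monomial, ← C_mul_X_pow_eq_monomial, ← C_mul_X_pow_eq_monomial,
          ← C_mul_X_pow_eq_monomial]
        simp only [map_mul, map_pow, weightedSubst_C_C, weightedSubst_C_X, weightedSubst_X]
        ring
      rw [this]
      simp only [coeff_monomial]
      grind [coeff_monomial, coeff_zero]

lemma coeff_weightedLienard (Λ ξ κ : F) (R : F[X][X]) (m : ℕ) :
    (weightedLienard Λ ξ κ R).coeff (m + 5) = Differential.mapCoeffs (R.coeff (m + 2))
      + C (ξ / 3) * (((m + 5 : ℕ) : F[X]) * R.coeff (m + 5))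
      - C (κ / 3) * X * (((m + 4 : ℕ) : F[X]) * R.coeff (m + 4))
      + (1 - X ^ 3) * derivative (R.coeff m) + C Λ * X * derivative (R.coeff (m + 2))
      - C (ξ / 3) * X * derivative (R.coeff (m + 5))
      + C (κ / 3) * X ^ 2 * derivative (R.coeff (m + 4)) := by
  have e1 : (X ^ 3 * scalarDerivative R).coeff (m + 5) = Differential.mapCoeffs (R.coeff (m + 2)) :=
    coeff_X_pow_mul _ 3 (m + 2)
  have e2 : (X * derivative R).coeff (m + 5) = ((m + 5 : ℕ) : F[X]) * R.coeff (m + 5) := by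
    rw [coeff_X_mul, coeff_derivative]; push_cast; ring
  have e3 : (X ^ 2 * derivative R).coeff (m + 5) = ((m + 4 : ℕ) : F[X]) * R.coeff (m + 4) := by
    rw [show m + 5 = (m + 3) + 2 from rfl, coeff_X_pow_mul, coeff_derivative]; push_cast; ring
  have e4 : (X ^ 5 * innerDerivative R).coeff (m + 5) = derivative (R.coeff m) :=
    coeff_X_pow_mul _ 5 m
  have e5 : (X ^ 3 * innerDerivative R).coeff (m + 5) = derivative (R.coeff (m + 2)) :=
    coeff_X_pow_mul _ 3 (m + 2)
  have e6 : (innerDerivative R).coeff (m + 5) = derivative (R.coeff (m + 5)) := rfl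
  have e7 : (X * innerDerivative R).coeff (m + 5) = derivative (R.coeff (m + 4)) :=
    coeff_X_mul _ (m + 4)
  rw [weightedLienard, bideriv_apply]
  simp only [add_mul, sub_mul, mul_assoc, coeff_add, coeff_sub, coeff_C_mul,
    e1, e2, e3, e4, e5, e6, e7]
  ring

omit [Differential F] in
lemma coeff_coeff_weightedSubst_add (P : F[X][X]) (j l : ℕ) :
    ((weightedSubst P).coeff (j + 3 * l)).coeff j = (P.coeff j).coeff l := by
  rw [coeff_coeff_weightedSubst, if_pos ⟨by omega, ⟨l, by omega⟩⟩]
  congr 1; omega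

omit [Differential F] in
lemma weightedSubst_eq_of_natDegree_le_two {P : F[X][X]} (h : (weightedSubst P).natDegree ≤ 2) :
    ∃ k0 k1 k2 : F, weightedSubst P = C (C k0) + C (C k1 * X) * X + C (C k2 * X ^ 2) * X ^ 2 := by
  refine ⟨(P.coeff 0).coeff 0, (P.coeff 1).coeff 0, (P.coeff 2).coeff 0, ?_⟩
  have hcoef : ∀ (k0 k1 k2 : F) (m : ℕ),
      (C (C k0) + C (C k1 * X) * X + C (C k2 * X ^ 2) * X ^ 2).coeff m =
        (if m = 0 then C k0 else 0) + (if m = 1 then C k1 * X else 0)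
          + if m = 2 then C k2 * X ^ 2 else 0 := by
    intro k0 k1 k2 m
    simp only [coeff_add, coeff_C_mul (n := m), coeff_C (n := m), coeff_X_pow, coeff_X,
      mul_ite, mul_one, mul_zero, @eq_comm ℕ 1]
  ext m j
  rw [hcoef]
  by_cases hm : 2 < m
  · rw [coeff_eq_zero_of_natDegree_lt (h.trans_lt hm)]
    simp [show m ≠ 0 by omega, show m ≠ 1 by omega, show m ≠ 2 by omega]
  · rw [coeff_coeff_weightedSubst]
    interval_cases m
    · by_cases hj : j = 0 <;> simp [coeff_C, hj]
    · by_cases hj : j = 1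
      · simp [hj]
      · have : ¬ (j ≤ 1 ∧ 3 ∣ 1 - j) := by omega
        simp [this, coeff_X, Ne.symm hj]
    · by_cases hj : j = 2
      · simp [hj]
      · have : ¬ (j ≤ 2 ∧ 3 ∣ 2 - j) := by omega
        simp [this, coeff_X_pow, hj]

/-- A Darboux polynomial of a Liénard system is a scalar. -/
theorem eq_C_C_of_dvd_lienard [CharZero F] {Λ ξ κ : F} (hΛ : Differential.deriv Λ = 0)
    (hκ : κ ≠ 0) {P : F[X][X]} (hP : P ≠ 0) (hdvd : P ∣ lienard Λ ξ κ P) :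
    ∃ c, P = C (C c) := by
  obtain ⟨K, hK⟩ := hdvd
  set Q := weightedSubst P with hQ
  have hcoef : ∀ j l, (Q.coeff (j + 3 * l)).coeff j = (P.coeff j).coeff l :=
    coeff_coeff_weightedSubst_add P
  have hQ0 : Q ≠ 0 := by
    intro h0
    apply hP
    ext j l
    rw [← hcoef, h0]; simp
  set N := Q.natDegree with hN
  have hDQ : weightedLienard Λ ξ κ Q = X ^ 3 * (Q * weightedSubst K) := by
    rw [hQ, weightedLienard_weightedSubst, hK, map_mul]
  have hL : (weightedSubst K).natDegree ≤ 2 := by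
    by_cases hL0 : weightedSubst K = 0
    · simp [hL0]
    have h1 : (weightedLienard Λ ξ κ Q).natDegree ≤ N + 5 := by
      rw [natDegree_le_iff_coeff_eq_zero]
      intro n hn
      obtain ⟨m, rfl⟩ : ∃ m, n = m + 5 := ⟨n - 5, by omega⟩
      have hz : ∀ r, m ≤ r → Q.coeff r = 0 := fun r hr =>
        coeff_eq_zero_of_natDegree_lt (by omega)
      rw [coeff_weightedLienard, hz _ le_rfl, hz (m + 2) (by omega), hz (m + 4) (by omega),
        hz (m + 5) (by omega)]
      simp
    rw [hDQ, natDegree_mul (by simp) (mul_ne_zero hQ0 hL0), natDegree_mul hQ0 hL0,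
      natDegree_X_pow] at h1
    omega
  obtain ⟨k0, k1, k2, hL⟩ := weightedSubst_eq_of_natDegree_le_two hL
  set R := X ^ 4 * Q with hR
  have hDR : weightedLienard Λ ξ κ R = X ^ 3 * (R * weightedSubst K)
      + (4 * C (C (ξ / 3)) - 4 * C (C (κ / 3) * X) * X) * R := by
    rw [hR, Derivation.leibniz, hDQ, Derivation.leibniz_pow, weightedLienard, bideriv_X]
    simp only [smul_eq_mul, nsmul_eq_mul, Nat.cast_ofNat]
    ring
  have key : ∀ m : ℕ, Differential.mapCoeffs (R.coeff (m + 2))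
      + (m + 1 : F[X]) * C (ξ / 3) * R.coeff (m + 5)
      + C (κ / 3) * (X ^ 2 * derivative (R.coeff (m + 4)) - (m : F[X]) * X * R.coeff (m + 4))
      + (1 - X ^ 3) * derivative (R.coeff m) + C Λ * X * derivative (R.coeff (m + 2))
      - C (ξ / 3) * X * derivative (R.coeff (m + 5))
      = C k2 * X ^ 2 * R.coeff m + C k1 * X * R.coeff (m + 1) + C k0 * R.coeff (m + 2) := by
    intro m
    have h1 := congrArg (fun S => S.coeff (m + 5)) hDR
    have e1 : (X ^ 3 * (R * weightedSubst K)).coeff (m + 5) =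
        C k2 * X ^ 2 * R.coeff m + C k1 * X * R.coeff (m + 1) + C k0 * R.coeff (m + 2) := by
      rw [show m + 5 = m + 2 + 3 from rfl, coeff_X_pow_mul, hL,
        show R * (C (C k0) + C (C k1 * X) * X + C (C k2 * X ^ 2) * X ^ 2) =
          C (C k0) * R + C (C k1 * X) * (X * R) + C (C k2 * X ^ 2) * (X ^ 2 * R) by ring]
      simp only [coeff_add, coeff_C_mul, coeff_X_mul, coeff_X_pow_mul]
      ring
    have e2 : ((4 * C (C (ξ / 3)) - 4 * C (C (κ / 3) * X) * X) * R).coeff (m + 5) =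
        4 * C (ξ / 3) * R.coeff (m + 5) - 4 * C (κ / 3) * X * R.coeff (m + 4) := by
      have : (4 * C (C (ξ / 3)) - 4 * C (C (κ / 3) * X) * X) * R =
          C (4 * C (ξ / 3)) * R - C (4 * (C (κ / 3) * X)) * (X * R) := by
        simp only [C_mul, map_ofNat]; ring
      rw [this, coeff_sub, coeff_C_mul, coeff_C_mul, coeff_X_mul]
      ring
    simp only [coeff_add, e1, e2, coeff_weightedLienard] at h1
    push_cast at h1
    linear_combination h1
  have hz : ∀ r, N + 4 < r → R.coeff r = 0 := fun r hr => by
    apply coeff_eq_zero_of_natDegree_lt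
    rw [hR, natDegree_mul (by simp) hQ0, natDegree_X_pow]
    omega
  have hR4 : R.coeff (N + 4) = Q.coeff N := coeff_X_pow_mul _ 4 N
  have hN0 : N = 0 := by
    refine quasi_degree_eq_zero (p0 := R.coeff (N + 4)) (p1 := R.coeff (N + 3))
      (p2 := R.coeff (N + 2)) (p3 := R.coeff (N + 1)) (p4 := R.coeff N) (Λ := Λ) (k0 := k0)
      (k1 := k1) (k2 := k2) hΛ hκ ?_ ?_ ?_ ?_ ?_ ?_ ?_
    · rw [hR4]; exact leadingCoeff_ne_zero.mpr hQ0
    · rw [hR4, natDegree_le_iff_coeff_eq_zero]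
      intro j hj
      rw [hQ, coeff_coeff_weightedSubst, if_neg (by omega)]
    · rw [hR4, hQ, coeff_coeff_weightedSubst, hR, coeff_X_pow_mul']
      split_ifs with h1 h2 h3
      · intro _
        rw [hQ, coeff_coeff_weightedSubst, if_neg (by omega)]
      · simp
      · simp
      · simp
    · have := key (N + 4)
      simpa [hz] using this
    · have := key (N + 3)
      simpa [hz] using this
    · have := key (N + 2)
      simp only [hz (N + 2 + 4) (by omega), hz (N + 2 + 5) (by omega)] at this
      simp only [mul_zero, map_zero, sub_zero, add_zero] at this
      linear_combination this
    · have := key N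
      simp only [hz (N + 5) (by omega)] at this
      simp only [mul_zero, map_zero, sub_zero, add_zero] at this
      linear_combination this
  refine ⟨(P.coeff 0).coeff 0, ?_⟩
  ext j l
  by_cases hjl : j = 0 ∧ l = 0
  · simp [hjl.1, hjl.2]
  · have hlt : Q.natDegree < j + 3 * l := by omega
    rw [← hcoef, coeff_eq_zero_of_natDegree_lt hlt, coeff_C]
    split_ifs with hj
    · rw [coeff_C, if_neg (by tauto), coeff_zero]
    · rfl

end lienard

section dichotomy
open scoped Differential
variable {F K : Type*} [Field F] [CharZero F] [Differential F] [Field K] [Differential K]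
  [Algebra F K] [DifferentialAlgebra F K]

/-- Evaluation of a bivariate polynomial at `(V, Z)`, with `V` the outer variable. -/
noncomputable def evalPair (F : Type*) {K : Type*} [Field F] [Field K] [Algebra F K] (V Z : K) :
    F[X][X] →+* K :=
  eval₂RingHom (aeval Z : F[X] →ₐ[F] K).toRingHom V

omit [CharZero F] [Differential F] [Differential K] [DifferentialAlgebra F K] in
lemma evalPair_C (V Z : K) (p : F[X]) : evalPair F V Z (C p) = aeval Z p := by simp [evalPair]
omit [CharZero F] [Differential F] [Differential K] [DifferentialAlgebra F K] in
lemma evalPair_C_C (V Z : K) (c : F) : evalPair F V Z (C (C c)) = algebraMap F K c := by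
  simp [evalPair]
omit [CharZero F] [Differential F] [Differential K] [DifferentialAlgebra F K] in
lemma evalPair_X (V Z : K) : evalPair F V Z X = V := by simp [evalPair]

omit [CharZero F] in
lemma deriv_evalPair {V Z : K} {Λ ξ κ : F}
    (hV : V′ = Z - V ^ 3 + algebraMap F K Λ * V)
    (hZ : Z′ = algebraMap F K ξ - algebraMap F K κ * V) (P : F[X][X]) :
    (evalPair F V Z P)′ = evalPair F V Z (lienard Λ ξ κ P) := by
  rw [← one_mul (evalPair F V Z (lienard Λ ξ κ P))]
  refine map_derivation_eq (evalPair F V Z) (lienard Λ ξ κ) (fun x => x′) 1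
    (map_add _) (fun a b => by simp) ?_ ?_ ?_ P
  · intro c
    simp only [lienard, bideriv_C_C, one_mul, evalPair_C_C, deriv_algebraMap]
  · simp only [lienard, bideriv_C_X, one_mul, map_sub, map_mul, evalPair_X,
      evalPair_C, aeval_X, aeval_C, hZ]
  · simp only [lienard, bideriv_X, one_mul, map_sub, map_add, map_mul, map_pow,
      evalPair_X, evalPair_C, aeval_X, aeval_C, hV]

lemma evalPair_injective {V Z : K} {Λ ξ κ : F} (hΛ : Λ′ = 0) (hκ : κ ≠ 0)
    (hV : V′ = Z - V ^ 3 + algebraMap F K Λ * V)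
    (hZ : Z′ = algebraMap F K ξ - algebraMap F K κ * V) (ht : Transcendental F Z) :
    Function.Injective (evalPair F V Z) := by
  have hZ0 : ∀ q : F[X], aeval Z q = 0 → q = 0 := fun q hq =>
    (transcendental_iff.mp ht) q hq
  rw [RingHom.injective_iff_ker_eq_bot]
  by_contra hker
  obtain ⟨p, hpk, hp⟩ := Ideal.IsPrime.exists_mem_prime_of_ne_bot
    (RingHom.ker_isPrime (evalPair F V Z)) hker
  rw [RingHom.mem_ker] at hpk
  have hDk : evalPair F V Z (lienard Λ ξ κ p) = 0 := by
    rw [← deriv_evalPair hV hZ, hpk, map_zero]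
  have hndvd : ¬ p ∣ lienard Λ ξ κ p := by
    intro hdvd
    obtain ⟨c, rfl⟩ := eq_C_C_of_dvd_lienard hΛ hκ hp.ne_zero hdvd
    rw [evalPair_C_C, map_eq_zero] at hpk
    exact hp.ne_zero (by simp [hpk])
  have hdeg : p.natDegree ≠ 0 := by
    intro h0
    rw [eq_C_of_natDegree_eq_zero h0, evalPair_C] at hpk
    apply hp.ne_zero
    rw [eq_C_of_natDegree_eq_zero h0, hZ0 _ hpk, C_0]
  have hinj : Function.Injective (algebraMap F[X] (FractionRing F[X])) :=
    IsFractionRing.injective _ _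
  have hirr : Irreducible (p.map (algebraMap F[X] (FractionRing F[X]))) :=
    ((hp.irreducible.isPrimitive hdeg).irreducible_iff_irreducible_map_fraction_map).mp
      hp.irreducible
  rcases hirr.isCoprime_or_dvd ((lienard Λ ξ κ p).map (algebraMap F[X] (FractionRing F[X])))
    with hco | hd
  · have hunit : ∀ y : nonZeroDivisors F[X], IsUnit ((aeval Z : F[X] →ₐ[F] K).toRingHom y) := by
      intro y
      rw [isUnit_iff_ne_zero]
      intro h
      exact nonZeroDivisors.coe_ne_zero y (hZ0 _ h)
    have hmap : ∀ q : F[X][X], (q.map (algebraMap F[X] (FractionRing F[X]))).eval₂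
        (IsLocalization.lift hunit) V = evalPair F V Z q := by
      intro q
      rw [eval₂_map, IsLocalization.lift_comp]
      rfl
    obtain ⟨a, b, hab⟩ := hco
    have := congrArg (eval₂ (IsLocalization.lift hunit) V) hab
    rw [eval₂_add, eval₂_mul, eval₂_mul, hmap, hmap, hpk, hDk, eval₂_one] at this
    simp at this
  · obtain ⟨q, hq⟩ := hd
    obtain ⟨b, hbm, hb⟩ :=
      IsLocalization.integerNormalization_spec (nonZeroDivisors F[X]) q
    have h1 : p * IsLocalization.integerNormalization (nonZeroDivisors F[X]) q
        = C b * lienard Λ ξ κ p := by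
      apply map_injective _ hinj
      rw [Polynomial.map_mul, Polynomial.map_mul, hb, hq, map_C, Algebra.smul_def]
      simp only [Polynomial.algebraMap_apply]
      ring
    rcases hp.dvd_or_dvd (Dvd.intro _ h1) with h2 | h2
    · obtain ⟨r, hr⟩ := h2
      have h3 := congrArg (evalPair F V Z) hr
      rw [map_mul, hpk, zero_mul, evalPair_C] at h3
      exact nonZeroDivisors.ne_zero hbm (hZ0 _ h3)
    · exact hndvd h2

/-- If `F` has no nonzero `e` with `e′ = n c e`, `n > 0`, neither has any algebraic extension. -/
lemma eq_zero_of_isAlgebraic_of_exponential {c : F}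
    (hF : ∀ n : ℕ, 0 < n → ∀ e : F, e′ = n * c * e → e = 0) {n : ℕ} (hn : 0 < n) {x : K}
    (hx : IsAlgebraic F x) (hxc : x′ = n * algebraMap F K c * x) : x = 0 := by
  have hint := hx.isIntegral
  set m := minpoly F x with hm
  have hd : 0 < m.natDegree := minpoly.natDegree_pos hint
  set q : F[X] := Differential.mapCoeffs m
    + C (n * c) * (X * derivative m - (m.natDegree : F[X]) * m) with hq
  have hqx : aeval x q = 0 := by
    have h1 := Differential.deriv_aeval_eq x m
    rw [hm, minpoly.aeval, map_zero, hxc] at h1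
    rw [hq, hm]
    simp only [map_add, map_mul, map_sub, aeval_X, aeval_C, minpoly.aeval, map_natCast]
    linear_combination -h1
  have hcoef : ∀ j, q.coeff j = (m.coeff j)′ + n * c * ((j - m.natDegree) * m.coeff j) := by
    intro j
    rw [hq, coeff_add, Differential.coeff_mapCoeffs, coeff_C_mul, coeff_sub,
      ← C_eq_natCast, coeff_C_mul]
    cases j with
    | zero => simp
    | succ j => rw [coeff_X_mul, coeff_derivative]; push_cast; ring
  have hq0 : q = 0 := by
    by_contra hne
    have hle := minpoly.degree_le_of_ne_zero F x hne hqx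
    rw [← hm] at hle
    have hle' : m.natDegree ≤ q.natDegree := natDegree_le_natDegree hle
    apply hne
    rw [← leadingCoeff_eq_zero, leadingCoeff, hcoef]
    rcases hle'.eq_or_lt with h | h
    · rw [← h, show m.coeff m.natDegree = 1 from minpoly.monic hint]; simp
    · rw [coeff_eq_zero_of_natDegree_lt h]; simp
  have h0 := hcoef 0
  rw [hq0, coeff_zero] at h0
  have := hF (m.natDegree * n) (Nat.mul_pos hd hn) (m.coeff 0) (by
    push_cast at h0 ⊢
    linear_combination -h0)
  exact (minpoly.coeff_zero_eq_zero hint).mp this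

lemma deriv_mem_algebraicClosure {x : K} (hx : x ∈ algebraicClosure F K) :
    x′ ∈ algebraicClosure F K := by
  have halg := mem_algebraicClosure_iff.mp hx
  have haeval : ∀ p : F[X], aeval x p ∈ algebraicClosure F K := fun p =>
    (Algebra.adjoin_singleton_le (S := (algebraicClosure F K).toSubalgebra) hx)
      (aeval_mem_adjoin_singleton F x)
  have h1 := Differential.deriv_aeval_eq x (minpoly F x)
  rw [minpoly.aeval, map_zero] at h1
  have h2 : aeval x (derivative (minpoly F x)) ≠ 0 :=
    Separable.aeval_derivative_ne_zero (minpoly.irreducible halg.isIntegral).separable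
      (minpoly.aeval F x)
  have h3 : x′ = -aeval x (Differential.mapCoeffs (minpoly F x))
      / aeval x (derivative (minpoly F x)) := by
    rw [eq_div_iff h2]; linear_combination -h1
  rw [h3]
  exact div_mem (neg_mem (haeval _)) (haeval _)

omit [CharZero F] [Differential F] [Differential K] [DifferentialAlgebra F K] in
lemma exists_evalPair_div {V Z x : K} (hx : x ∈ IntermediateField.adjoin F {V, Z}) :
    ∃ P Q : F[X][X], x = evalPair F V Z P / evalPair F V Z Q := by
  have hrange : ∀ r ∈ Algebra.adjoin F {V, Z}, ∃ P : F[X][X], r = evalPair F V Z P := by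
    intro r hr
    induction hr using Algebra.adjoin_induction with
    | mem y hy =>
      rcases hy with rfl | rfl
      · exact ⟨X, (evalPair_X _ _).symm⟩
      · exact ⟨C X, by rw [evalPair_C, aeval_X]⟩
    | algebraMap c => exact ⟨C (C c), (evalPair_C_C _ _ _).symm⟩
    | add a b _ _ ha hb =>
      obtain ⟨P, rfl⟩ := ha
      obtain ⟨Q, rfl⟩ := hb
      exact ⟨P + Q, (map_add _ _ _).symm⟩
    | mul a b _ _ ha hb =>
      obtain ⟨P, rfl⟩ := ha
      obtain ⟨Q, rfl⟩ := hb
      exact ⟨P * Q, (map_mul _ _ _).symm⟩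
  obtain ⟨r, hr, s, hs, rfl⟩ := IntermediateField.mem_adjoin_iff_div.mp hx
  obtain ⟨P, rfl⟩ := hrange r hr
  obtain ⟨Q, rfl⟩ := hrange s hs
  exact ⟨P, Q, rfl⟩

omit [CharZero F] [Differential F] [Differential K] [DifferentialAlgebra F K] in
lemma evalPair_mem_adjoin (V Z : K) (P : F[X][X]) :
    evalPair F V Z P ∈ IntermediateField.adjoin F {V, Z} := by
  induction P using bivariate_induction with
  | hC c => rw [evalPair_C_C]; exact IntermediateField.algebraMap_mem _ _
  | hZ => rw [evalPair_C, aeval_X]; exact IntermediateField.subset_adjoin _ _ (by simp)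
  | hV => rw [evalPair_X]; exact IntermediateField.subset_adjoin _ _ (by simp)
  | hadd P Q hP hQ => rw [map_add]; exact add_mem hP hQ
  | hmul P Q hP hQ => rw [map_mul]; exact mul_mem hP hQ

lemma eq_zero_of_mem_adjoin_of_exponential {V Z : K} {Λ ξ κ c : F} (hΛ : Λ′ = 0) (hκ : κ ≠ 0)
    (hV : V′ = Z - V ^ 3 + algebraMap F K Λ * V)
    (hZ : Z′ = algebraMap F K ξ - algebraMap F K κ * V) (ht : Transcendental F Z)
    (hF : ∀ e : F, e′ = c * e → e = 0) {x : K}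
    (hx : x ∈ IntermediateField.adjoin F {V, Z}) (hxc : x′ = algebraMap F K c * x) : x = 0 := by
  have hinj := evalPair_injective hΛ hκ hV hZ ht
  have hne : ∀ P : F[X][X], P ≠ 0 → evalPair F V Z P ≠ 0 := fun P hP h =>
    hP (hinj (by rw [h, map_zero]))
  by_contra hx0
  obtain ⟨P₀, Q₀, rfl⟩ := exists_evalPair_div hx
  have hP₀ : P₀ ≠ 0 := by rintro rfl; simp at hx0
  have hQ₀ : Q₀ ≠ 0 := by rintro rfl; simp at hx0
  obtain ⟨P, Q, G, hrel, rfl, rfl⟩ := UniqueFactorizationMonoid.exists_reduced_factors P₀ hP₀ Q₀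
  have hP := right_ne_zero_of_mul hP₀
  have hQ := right_ne_zero_of_mul hQ₀
  have hG := left_ne_zero_of_mul hP₀
  rw [map_mul, map_mul, mul_div_mul_left _ _ (hne G hG)] at hxc
  have hDP : lienard Λ ξ κ P * Q - P * lienard Λ ξ κ Q = C (C c) * P * Q := by
    apply hinj
    have hQ' := hne Q hQ
    rw [Derivation.leibniz_div, deriv_evalPair hV hZ, deriv_evalPair hV hZ] at hxc
    simp only [map_mul, map_sub, evalPair_C_C]
    simp only [smul_eq_mul] at hxc
    field_simp at hxc
    linear_combination hxc
  have h1 : P ∣ lienard Λ ξ κ P :=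
    hrel.dvd_of_dvd_mul_right ⟨lienard Λ ξ κ Q + C (C c) * Q, by linear_combination hDP⟩
  have h2 : Q ∣ lienard Λ ξ κ Q :=
    hrel.symm.dvd_of_dvd_mul_left ⟨lienard Λ ξ κ P - C (C c) * P, by linear_combination -hDP⟩
  obtain ⟨a, rfl⟩ := eq_C_C_of_dvd_lienard hΛ hκ hP h1
  obtain ⟨b, rfl⟩ := eq_C_C_of_dvd_lienard hΛ hκ hQ h2
  rw [evalPair_C_C, evalPair_C_C, ← map_div₀, deriv_algebraMap, ← map_mul] at hxc
  have h3 := hF (a / b) ((algebraMap F K).injective hxc)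
  rw [div_eq_zero_iff] at h3
  rcases h3 with rfl | rfl
  · simp at hP
  · simp at hQ

/-- A solution of a Liénard system can be adjoined without creating exponentials. -/
theorem exists_intermediateField_of_lienard {V Z : K} {Λ ξ κ c : F} (hΛ : Λ′ = 0) (hκ : κ ≠ 0)
    (hV : V′ = Z - V ^ 3 + algebraMap F K Λ * V)
    (hZ : Z′ = algebraMap F K ξ - algebraMap F K κ * V)
    (hF : ∀ n : ℕ, 0 < n → ∀ e : F, e′ = n * c * e → e = 0) :
    ∃ L : IntermediateField F K, (∀ x ∈ L, x′ ∈ L) ∧ V ∈ L ∧ Z ∈ L ∧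
      ∀ n : ℕ, 0 < n → ∀ e ∈ L, e′ = n * algebraMap F K c * e → e = 0 := by
  by_cases ht : Transcendental F Z
  · refine ⟨IntermediateField.adjoin F {V, Z}, ?_, IntermediateField.subset_adjoin _ _ (by simp),
      IntermediateField.subset_adjoin _ _ (by simp), ?_⟩
    · intro x hx
      obtain ⟨P, Q, rfl⟩ := exists_evalPair_div hx
      rw [Derivation.leibniz_div, deriv_evalPair hV hZ, deriv_evalPair hV hZ]
      simp only [smul_eq_mul]
      have := evalPair_mem_adjoin (F := F) V Z
      exact mul_mem (pow_mem (inv_mem (this _)) 2)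
        (sub_mem (mul_mem (this _) (this _)) (mul_mem (this _) (this _)))
    · intro n hn e he hec
      refine eq_zero_of_mem_adjoin_of_exponential (c := n * c) hΛ hκ hV hZ ht (hF n hn) he ?_
      rw [hec, map_mul, map_natCast]
  · have hZm : Z ∈ algebraicClosure F K :=
      mem_algebraicClosure_iff.mpr (not_not.mp ht)
    have hstable : ∀ x ∈ algebraicClosure F K, x′ ∈ algebraicClosure F K := fun x hx =>
      deriv_mem_algebraicClosure hx
    refine ⟨algebraicClosure F K, hstable, ?_, hZm, ?_⟩
    · have hκ' : algebraMap F K κ ≠ 0 := by simpa using hκ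
      have : V = (algebraMap F K ξ - Z′) / algebraMap F K κ := by
        rw [eq_div_iff hκ', hZ]; ring
      rw [this]
      exact div_mem (sub_mem (IntermediateField.algebraMap_mem _ _) (hstable _ hZm))
        (IntermediateField.algebraMap_mem _ _)
    · intro n hn e he hec
      exact eq_zero_of_isAlgebraic_of_exponential hF hn (mem_algebraicClosure_iff.mp he) hec

end dichotomy

section network
open scoped Differential
variable {K : Type*} [Field K] [Differential K]

/-- The subfield of constants of a differential field. -/
def constantSubfield (K : Type*) [Field K] [Differential K] : Subfield K where
  carrier := {x | x′ = 0}
  mul_mem' {a b} ha hb := by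
    simp only [Set.mem_ofPred_eq] at ha hb ⊢
    rw [Derivation.leibniz, ha, hb]; simp
  one_mem' := by simp
  add_mem' {a b} ha hb := by
    simp only [Set.mem_ofPred_eq] at ha hb ⊢
    rw [map_add, ha, hb, add_zero]
  zero_mem' := by simp
  neg_mem' {a} ha := by
    simp only [Set.mem_ofPred_eq] at ha ⊢
    rw [map_neg, ha, neg_zero]
  inv_mem' a ha := by
    simp only [Set.mem_ofPred_eq] at ha ⊢
    rw [Derivation.leibniz_inv, ha, smul_zero]

/-- The restriction of the derivation to a stable subfield. -/
@[reducible]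
def differentialSubfield (S : Subfield K) (hS : ∀ x ∈ S, x′ ∈ S) : Differential S where
  deriv := Derivation.mk'
    ({ toFun := fun x => ⟨(x : K)′, hS x x.2⟩
       map_add' := fun a b => by ext; simp
       map_zero' := by ext; simp } : S →+ S).toIntLinearMap
    (fun a b => by ext; simp)

lemma exists_subfield_of_lienard_family [CharZero K] {ι : Type*} (s : Finset ι) {V Z Λ : ι → K}
    {ξ κ c : K} (hΛ : ∀ k, (Λ k)′ = 0) (hξ : ξ′ = 0) (hκ : κ′ = 0) (hκ0 : κ ≠ 0) (hc : c′ = 0)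
    (hc0 : c ≠ 0) (hV : ∀ k, (V k)′ = Z k - V k ^ 3 + Λ k * V k)
    (hZ : ∀ k, (Z k)′ = ξ - κ * V k) :
    ∃ S : Subfield K, constantSubfield K ≤ S ∧ (∀ x ∈ S, x′ ∈ S) ∧ (∀ k ∈ s, V k ∈ S) ∧
      ∀ n : ℕ, 0 < n → ∀ e ∈ S, e′ = n * c * e → e = 0 := by
  induction s using Finset.cons_induction with
  | empty =>
    refine ⟨constantSubfield K, le_rfl, ?_, by simp, ?_⟩
    · intro x hx
      rw [show x′ = 0 from hx]
      exact zero_mem _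
    · intro n hn e he hec
      rw [show e′ = 0 from he] at hec
      simpa [hc0, hn.ne'] using hec.symm
  | cons k s hk ih =>
    obtain ⟨S, hconst, hstable, hmem, hexp⟩ := ih
    let _ := differentialSubfield S hstable
    have : DifferentialAlgebra S K := ⟨fun a => rfl⟩
    obtain ⟨L, hL, hVL, -, hexpL⟩ := exists_intermediateField_of_lienard (F := S) (K := K)
      (V := V k) (Z := Z k) (Λ := ⟨Λ k, hconst (hΛ k)⟩) (ξ := ⟨ξ, hconst hξ⟩)
      (κ := ⟨κ, hconst hκ⟩) (c := ⟨c, hconst hc⟩) (Subtype.ext (hΛ k))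
      (fun h => hκ0 (congrArg Subtype.val h)) (hV k) (hZ k) (by
        intro n hn e he
        apply Subtype.ext
        apply hexp n hn e e.2
        exact congrArg Subtype.val he)
    have hSL : S ≤ L.toSubfield := fun x hx => L.algebraMap_mem ⟨x, hx⟩
    refine ⟨L.toSubfield, hconst.trans hSL, hL, ?_, hexpL⟩
    intro j hj
    rcases Finset.mem_cons.mp hj with rfl | hj
    · exact hVL
    · exact hSL (hmem j hj)

/-- Solutions of Liénard systems do not combine to a trigonometric forcing. -/
theorem false_of_lienard_forcing [CharZero K] {ι : Type*} [Fintype ι] {V Z Λ : ι → K}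
    {ξ κ c a b E E' : K} (hΛ : ∀ k, (Λ k)′ = 0) (hξ : ξ′ = 0) (hκ : κ′ = 0) (hκ0 : κ ≠ 0)
    (hc : c′ = 0) (hc0 : c ≠ 0) (ha : a′ = 0) (hb : b′ = 0)
    (hV : ∀ k, (V k)′ = Z k - V k ^ 3 + Λ k * V k) (hZ : ∀ k, (Z k)′ = ξ - κ * V k)
    (hE : E′ = c * E) (hE' : E'′ = -(c * E')) (hEE : E * E' = 1)
    (hrel : E - E' = a + b * ∑ k, (V k)′) : False := by
  obtain ⟨S, hconst, hstable, hmem, hexp⟩ := exists_subfield_of_lienard_family Finset.univ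
    hΛ hξ hκ hκ0 hc hc0 hV hZ
  have h1 : E - E' ∈ S := by
    rw [hrel]
    exact add_mem (hconst ha) (mul_mem (hconst hb)
      (sum_mem fun k _ => hstable _ (hmem k (Finset.mem_univ k))))
  have h2 : E + E' ∈ S := by
    have h3 := hstable _ h1
    rw [map_sub, hE, hE', show c * E - -(c * E') = c * (E + E') by ring] at h3
    have h4 := mul_mem (inv_mem (hconst hc)) h3
    rwa [inv_mul_cancel_left₀ hc0] at h4
  have h3 : E ∈ S := by
    have h4 := mul_mem (inv_mem (ofNat_mem S 2)) (add_mem h1 h2)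
    rwa [show E - E' + (E + E') = 2 * E by ring, inv_mul_cancel_left₀ two_ne_zero] at h4
  have h4 := hexp 1 one_pos E h3 (by rw [hE]; simp)
  rw [h4, zero_mul] at hEE
  exact zero_ne_one hEE

end network

section extension
open scoped Differential
variable {A : Type*} [CommRing A] [Algebra ℚ A] {d : A → A}

omit [Algebra ℚ A] in
lemma deriv_pow_succ (hmul : ∀ a b, d (a * b) = a * d b + b * d a) (a : A) (n : ℕ) :
    d (a ^ (n + 1)) = (n + 1) * (a ^ n * d a) := by
  induction n with
  | zero => simp
  | succ n ih => rw [pow_succ, hmul, ih]; push_cast; ring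

/-- A maximal stable ideal of a differential `ℚ`-algebra is prime. -/
lemma isPrime_of_maximal_stable (hadd : ∀ a b, d (a + b) = d a + d b)
    (hmul : ∀ a b, d (a * b) = a * d b + b * d a) {J : Ideal A} (hJ1 : 1 ∉ J)
    (hJd : ∀ a ∈ J, d a ∈ J)
    (hmax : ∀ I : Ideal A, J ≤ I → 1 ∉ I → (∀ a ∈ I, d a ∈ I) → I ≤ J) : J.IsPrime := by
  have hd0 : d 0 = 0 := by simpa using hadd 0 0
  have hQ : ∀ (n : ℕ) (a : A), (n + 1) * a ∈ J → a ∈ J := by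
    intro n a h
    have h2 := J.mul_mem_left (algebraMap ℚ A (n + 1)⁻¹) h
    have h3 : algebraMap ℚ A (n + 1)⁻¹ * (n + 1) = 1 := by
      have : ((n : ℚ) + 1)⁻¹ * (n + 1) = 1 := inv_mul_cancel₀ (by positivity)
      simpa using congrArg (algebraMap ℚ A) this
    rwa [← mul_assoc, h3, one_mul] at h2
  have hsat : ∀ a, (∀ n : ℕ, a ^ n ∉ J) → ∀ (n : ℕ) (x : A), a ^ n * x ∈ J → x ∈ J := by
    intro a ha
    let T : Ideal A :=
      { carrier := {x | ∃ n : ℕ, a ^ n * x ∈ J}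
        zero_mem' := ⟨0, by simp⟩
        add_mem' := by
          rintro x y ⟨n, hn⟩ ⟨m, hm⟩
          refine ⟨n + m, ?_⟩
          rw [show a ^ (n + m) * (x + y) = a ^ m * (a ^ n * x) + a ^ n * (a ^ m * y) by ring]
          exact J.add_mem (J.mul_mem_left _ hn) (J.mul_mem_left _ hm)
        smul_mem' := by
          rintro r x ⟨n, hn⟩
          refine ⟨n, ?_⟩
          rw [smul_eq_mul, mul_left_comm]
          exact J.mul_mem_left _ hn }
    have hT : T ≤ J := by
      apply hmax T
      · intro x hx
        exact ⟨0, by simpa using hx⟩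
      · rintro ⟨n, hn⟩
        exact ha n (by simpa using hn)
      · rintro x ⟨n, hn⟩
        refine ⟨n + 1, ?_⟩
        have h1 := hJd _ (J.mul_mem_left a hn)
        rw [← mul_assoc, ← pow_succ', hmul, deriv_pow_succ hmul] at h1
        have h2 := J.mul_mem_left ((n + 1) * d a) hn
        have h3 := J.sub_mem h1 h2
        convert h3 using 1
        ring
    exact fun n x hx => hT ⟨n, hx⟩
  have hrad : J.radical ≤ J := by
    apply hmax _ J.le_radical
    · rintro ⟨n, hn⟩
      exact hJ1 (by simpa using hn)
    · intro a ha
      by_contra hda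
      have hda' : ∀ n : ℕ, d a ^ n ∉ J := fun n hn => hda ⟨n, hn⟩
      have hex : ∃ n : ℕ, a ^ n ∈ J := ha
      classical
      have hspec := Nat.find_spec hex
      rcases hn : Nat.find hex with _ | n
      · rw [hn, pow_zero] at hspec
        exact hJ1 hspec
      · rw [hn] at hspec
        have h1 := hJd _ hspec
        rw [deriv_pow_succ hmul] at h1
        have h2 := hQ n _ h1
        rw [mul_comm, ← pow_one (d a)] at h2
        exact Nat.find_min hex (by omega) (hsat _ hda' 1 _ h2)
  refine ⟨fun h => hJ1 (h ▸ Submodule.mem_top), ?_⟩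
  intro a b hab
  by_cases ha : a ∈ J
  · exact Or.inl ha
  · right
    exact hsat a (fun n hn => ha (hrad ⟨n, hn⟩)) 1 b (by rwa [pow_one])

omit [Algebra ℚ A] in
lemma exists_maximal_stable {I : Ideal A} (hI1 : 1 ∉ I)
    (hId : ∀ a ∈ I, d a ∈ I) :
    ∃ J : Ideal A, I ≤ J ∧ 1 ∉ J ∧ (∀ a ∈ J, d a ∈ J) ∧
      ∀ I' : Ideal A, J ≤ I' → 1 ∉ I' → (∀ a ∈ I', d a ∈ I') → I' ≤ J := by
  obtain ⟨J, hIJ, hJ⟩ := zorn_le_nonempty₀ {J : Ideal A | 1 ∉ J ∧ ∀ a ∈ J, d a ∈ J} (by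
    intro c hc hchain y hy
    have hmem : ∀ x, x ∈ sSup c ↔ ∃ J ∈ c, x ∈ J := fun x =>
      Submodule.mem_sSup_of_directed ⟨y, hy⟩ hchain.directedOn
    refine ⟨sSup c, ⟨?_, ?_⟩, fun J hJ => le_sSup hJ⟩
    · rw [hmem]
      rintro ⟨J, hJ, h1⟩
      exact (hc hJ).1 h1
    · intro a ha
      obtain ⟨J, hJ, haJ⟩ := (hmem a).mp ha
      exact (hmem _).mpr ⟨J, hJ, (hc hJ).2 a haJ⟩) I ⟨hI1, hId⟩
  exact ⟨J, hIJ, hJ.prop.1, hJ.prop.2, fun I' hle h1 hd => hJ.le_of_ge ⟨h1, hd⟩ hle⟩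

omit [Algebra ℚ A] in
lemma exists_differential_fractionRing (hadd : ∀ a b, d (a + b) = d a + d b)
    (hmul : ∀ a b, d (a * b) = a * d b + b * d a) {J : Ideal A} (hJd : ∀ a ∈ J, d a ∈ J)
    (K : Type*) [Field K] [Algebra (A ⧸ J) K] [IsFractionRing (A ⧸ J) K] :
    ∃ _ : Differential K, ∀ a,
      (algebraMap (A ⧸ J) K (Ideal.Quotient.mk J a))′ =
        algebraMap (A ⧸ J) K (Ideal.Quotient.mk J (d a)) := by
  set f : A →+* K := (algebraMap (A ⧸ J) K).comp (Ideal.Quotient.mk J) with hf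
  have hd0 : d 0 = 0 := by simpa using hadd 0 0
  have hd1 : d 1 = 0 := by simpa using hmul 1 1
  have hfJ : ∀ a ∈ J, f a = 0 := fun a ha => by
    rw [hf, RingHom.comp_apply, Ideal.Quotient.eq_zero_iff_mem.mpr ha, map_zero]
  let g : A →+* TrivSqZeroExt K K :=
    { toFun := fun a => TrivSqZeroExt.inl (f a) + TrivSqZeroExt.inr (f (d a))
      map_one' := by ext <;> simp [hd1]
      map_mul' := fun a b => by
        ext
        · simp
        · simp [hmul]; ring
      map_zero' := by ext <;> simp [hd0]
      map_add' := fun a b => by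
        rw [map_add, hadd, map_add, TrivSqZeroExt.inl_add, TrivSqZeroExt.inr_add]
        abel }
  have hgfst : ∀ a, (g a).fst = f a := fun a => by simp [g]
  have hgsnd : ∀ a, (g a).snd = f (d a) := fun a => by simp [g]
  let g₁ : A ⧸ J →+* TrivSqZeroExt K K := Ideal.Quotient.lift J g fun a ha => by
    ext
    · rw [hgfst, hfJ a ha]; rfl
    · rw [hgsnd, hfJ _ (hJd a ha)]; rfl
  have hg₁fst : ∀ b, (g₁ b).fst = algebraMap (A ⧸ J) K b := by
    intro b
    obtain ⟨a, rfl⟩ := Ideal.Quotient.mk_surjective b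
    exact hgfst a
  have hunit : ∀ y : nonZeroDivisors (A ⧸ J), IsUnit (g₁ y) := by
    intro y
    rw [TrivSqZeroExt.isUnit_iff_isUnit_fst, hg₁fst, isUnit_iff_ne_zero,
      map_ne_zero_iff _ (IsFractionRing.injective (A ⧸ J) K)]
    have : Nontrivial (A ⧸ J) := (algebraMap (A ⧸ J) K).domain_nontrivial
    exact nonZeroDivisors.coe_ne_zero y
  let G : K →+* TrivSqZeroExt K K := IsLocalization.lift hunit
  have hG : ∀ b, G (algebraMap (A ⧸ J) K b) = g₁ b := IsLocalization.lift_eq hunit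
  have hGfst : ∀ x, (G x).fst = x := by
    intro x
    have : ((TrivSqZeroExt.fstHom K K K).toRingHom.comp G) = RingHom.id K := by
      apply IsLocalization.ringHom_ext (nonZeroDivisors (A ⧸ J))
      ext b
      simp [hG, hg₁fst]
    exact congrArg (fun φ => φ x) this
  refine ⟨⟨Derivation.mk' ({ toFun := fun x => (G x).snd
                             map_zero' := by rw [map_zero, TrivSqZeroExt.snd_zero]
                             map_add' := fun x y => by
                              rw [map_add, TrivSqZeroExt.snd_add] } : K →+ K).toIntLinearMap
    fun x y => ?_⟩, ?_⟩
  · change (G (x * y)).snd = x • (G y).snd + y • (G x).snd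
    rw [map_mul, TrivSqZeroExt.snd_mul, hGfst, hGfst]
    simp [mul_comm]
  · intro a
    change (G (algebraMap (A ⧸ J) K (Ideal.Quotient.mk J a))).snd = _
    rw [hG]
    exact hgsnd a

/-- A nonzero differential `ℚ`-algebra maps to a differential field. -/
theorem exists_differential_field.{u} {A : Type u} [CommRing A] [Algebra ℚ A] {d : A → A}
    (hadd : ∀ a b, d (a + b) = d a + d b) (hmul : ∀ a b, d (a * b) = a * d b + b * d a)
    {I : Ideal A} (hI1 : 1 ∉ I) (hId : ∀ a ∈ I, d a ∈ I) :
    ∃ (K : Type u) (_ : Field K) (_ : CharZero K) (_ : Differential K) (f : A →+* K),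
      (∀ a, (f a)′ = f (d a)) ∧ ∀ a ∈ I, f a = 0 := by
  obtain ⟨J, hIJ, hJ1, hJd, hmax⟩ := exists_maximal_stable hI1 hId
  have := isPrime_of_maximal_stable hadd hmul hJ1 hJd hmax
  obtain ⟨δ, hδ⟩ := exists_differential_fractionRing hadd hmul hJd (FractionRing (A ⧸ J))
  have hchar : CharZero (FractionRing (A ⧸ J)) :=
    charZero_of_injective_algebraMap
      (((algebraMap (A ⧸ J) (FractionRing (A ⧸ J))).comp
        ((Ideal.Quotient.mk J).comp (algebraMap ℚ A))).injective)
  refine ⟨FractionRing (A ⧸ J), inferInstance, hchar, δ,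
    (algebraMap (A ⧸ J) (FractionRing (A ⧸ J))).comp (Ideal.Quotient.mk J), hδ, ?_⟩
  intro a ha
  rw [RingHom.comp_apply, Ideal.Quotient.eq_zero_iff_mem.mpr (hIJ ha), map_zero]

end extension

section orbit
open scoped Differential

lemma hasDerivAt_eval_mvPolynomial {σ : Type*} {γ : σ → ℝ → ℂ} {s : ℂ}
    {D : Derivation ℂ (MvPolynomial σ ℂ) (MvPolynomial σ ℂ)}
    (hγ : ∀ i t, HasDerivAt (γ i)
      (s * MvPolynomial.eval (fun j => γ j t) (D (MvPolynomial.X i))) t)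
    (P : MvPolynomial σ ℂ) (t : ℝ) :
    HasDerivAt (fun t => MvPolynomial.eval (fun j => γ j t) P)
      (s * MvPolynomial.eval (fun j => γ j t) (D P)) t := by
  induction P using MvPolynomial.induction_on with
  | C a => simpa using hasDerivAt_const t a
  | add p q hp hq =>
    simp only [map_add, mul_add]
    exact hp.add hq
  | mul_X p i hp =>
    have := hp.mul (hγ i t)
    simp only [map_mul, MvPolynomial.eval_X, Derivation.leibniz, map_add, smul_eq_mul]
    exact this.congr_deriv (by ring)

/-- A solution curve of a polynomial vector field generates a differential field in which every
polynomial relation holding along the curve is satisfied. -/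
lemma exists_differential_field_of_orbit {σ : Type} {γ : σ → ℝ → ℂ} {s : ℂ} (hs : s ≠ 0)
    {D : Derivation ℂ (MvPolynomial σ ℂ) (MvPolynomial σ ℂ)}
    (hγ : ∀ i t, HasDerivAt (γ i)
      (s * MvPolynomial.eval (fun j => γ j t) (D (MvPolynomial.X i))) t) :
    ∃ (K : Type) (_ : Field K) (_ : CharZero K) (_ : Differential K)
      (f : MvPolynomial σ ℂ →+* K), (∀ P, (f P)′ = f (D P)) ∧
      ∀ P, (∀ t, MvPolynomial.eval (fun j => γ j t) P = 0) → f P = 0 := by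
  let I : Ideal (MvPolynomial σ ℂ) :=
    ⨅ t : ℝ, RingHom.ker (MvPolynomial.eval fun j => γ j t)
  have hI : ∀ P, P ∈ I ↔ ∀ t, MvPolynomial.eval (fun j => γ j t) P = 0 := by
    intro P
    simp only [I, Ideal.mem_iInf, RingHom.mem_ker]
  obtain ⟨K, _, _, _, f, hf, hfI⟩ := exists_differential_field (d := D) (I := I)
    (fun a b => map_add D a b) (fun a b => by simp [Derivation.leibniz])
    (by rw [hI]; intro h; simpa using h 0)
    (by
      intro P hP
      rw [hI] at hP ⊢
      intro t
      have h1 := hasDerivAt_eval_mvPolynomial hγ P t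
      rw [funext hP] at h1
      exact (mul_eq_zero.mp (h1.unique (hasDerivAt_const t 0))).resolve_left hs)
  exact ⟨K, _, ‹_›, _, f, hf, fun P hP => hfI P ((hI P).mpr hP)⟩

lemma false_of_lienard_orbit {ι : Type} [Fintype ι] {v z : ι → ℝ → ℂ} {e e' : ℝ → ℂ}
    {Λ : ι → ℂ} {s ξ κ c a b : ℂ} (hs : s ≠ 0) (hκ : κ ≠ 0) (hc : c ≠ 0)
    (hv : ∀ k t, HasDerivAt (v k) (s * (z k t - v k t ^ 3 + Λ k * v k t)) t)
    (hz : ∀ k t, HasDerivAt (z k) (s * (ξ - κ * v k t)) t)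
    (he : ∀ t, HasDerivAt e (s * (c * e t)) t) (he' : ∀ t, HasDerivAt e' (s * -(c * e' t)) t)
    (hee : ∀ t, e t * e' t = 1)
    (hrel : ∀ t, e t - e' t = a + b * ∑ k, (z k t - v k t ^ 3 + Λ k * v k t)) : False := by
  let V : ι → MvPolynomial (ι ⊕ ι ⊕ Bool) ℂ := fun k => MvPolynomial.X (.inl k)
  let Z : ι → MvPolynomial (ι ⊕ ι ⊕ Bool) ℂ := fun k => MvPolynomial.X (.inr (.inl k))
  let E : Bool → MvPolynomial (ι ⊕ ι ⊕ Bool) ℂ := fun k => MvPolynomial.X (.inr (.inr k))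
  let C : ℂ →+* MvPolynomial (ι ⊕ ι ⊕ Bool) ℂ := MvPolynomial.C
  let W : ι ⊕ ι ⊕ Bool → MvPolynomial (ι ⊕ ι ⊕ Bool) ℂ :=
    Sum.elim (fun k => Z k - V k ^ 3 + C (Λ k) * V k)
      (Sum.elim (fun k => C ξ - C κ * V k)
        (fun k => bif k then C c * E true else -(C c * E false)))
  let γ : ι ⊕ ι ⊕ Bool → ℝ → ℂ := Sum.elim v (Sum.elim z (fun k => bif k then e else e'))
  obtain ⟨K, _, _, _, f, hf, hf0⟩ := exists_differential_field_of_orbit (γ := γ) hs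
    (D := MvPolynomial.mkDerivation ℂ W) (by
      rintro (k | k | k | k) t
      · simpa [γ, W, V, Z, C] using hv k t
      · simpa [γ, W, V, Z, C] using hz k t
      · simpa [γ, W, E, C] using he' t
      · simpa [γ, W, E, C] using he t)
  have hfC : ∀ u, (f (C u))′ = 0 := fun u => by
    rw [hf, show MvPolynomial.mkDerivation ℂ W (C u) = 0 from MvPolynomial.derivation_C _ u, map_zero]
  have hfX : ∀ k, (f (MvPolynomial.X k))′ = f (W k) := fun k => by
    rw [hf, MvPolynomial.mkDerivation_X]
  have hne : ∀ u, u ≠ 0 → f (C u) ≠ 0 := fun u hu =>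
    (map_ne_zero (f.comp C)).mpr hu
  have hV : ∀ k, (f (V k))′ = f (Z k) - f (V k) ^ 3 + f (C (Λ k)) * f (V k) := fun k => by
    rw [hfX]; simp [W]
  refine false_of_lienard_forcing (V := fun k => f (V k)) (Z := fun k => f (Z k))
    (Λ := fun k => f (C (Λ k))) (ξ := f (C ξ)) (κ := f (C κ)) (c := f (C c)) (a := f (C a))
    (b := f (C b)) (E := f (E true)) (E' := f (E false)) (fun k => hfC _) (hfC _) (hfC _)
    (hne _ hκ) (hfC _) (hne _ hc) (hfC _) (hfC _) hV
    (fun k => by rw [hfX]; simp [W]) (by rw [hfX]; simp [W]) (by rw [hfX]; simp [W]) ?_ ?_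
  · have := hf0 (E true * E false - 1) fun t => by simp [E, γ, hee t]
    rw [map_sub, map_mul, map_one] at this
    exact sub_eq_zero.mp this
  · have := hf0 (E true - E false - (C a + C b * ∑ k, (Z k - V k ^ 3 + C (Λ k) * V k)))
      fun t => by simp [E, V, Z, C, γ, hrel t]
    simp only [map_sub, map_add, map_mul, map_sum, map_pow] at this
    simp only [hV]
    exact sub_eq_zero.mp this

end orbit

section reduction

variable {N : ℕ} {φ β ε A ω : ℝ} {μ : Fin N → ℝ} {x y : Fin N → ℝ → ℝ}

lemma exists_const_of_synchronised
    (hx : ∀ i t, HasDerivAt (x i)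
      (y i t - x i t * ((x i t) ^ 2 / 3 - (φ + β * μ i)) + (x i t) ^ 2 / 2
        - (ε / (N : ℝ)) * ∑ k : Fin N, (x i t - x k t)) t)
    (hy : ∀ i t, HasDerivAt (y i) (-(x i t) + A * Real.sin (ω * t)) t)
    (hβ : β ≠ 0) {i j : Fin N} (hij : ∀ t : ℝ, x i t = x j t) (hμ : μ i ≠ μ j) :
    ∃ x₀, ∀ t, x i t = x₀ := by
  have hfun : x i = x j := funext hij
  have hd : ∀ t, HasDerivAt (fun t => y i t - y j t) 0 t := by
    intro t
    have := (hy i t).sub (hy j t)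
    rw [hij t, sub_self] at this
    exact this
  have hconst : ∀ t, y i t - y j t = y i 0 - y j 0 := fun t =>
    is_const_of_deriv_eq_zero (fun t => (hd t).differentiableAt) (fun t => (hd t).deriv) t 0
  refine ⟨-(y i 0 - y j 0) / (β * (μ i - μ j)), fun t => ?_⟩
  have h := (hx i t).unique (hfun ▸ hx j t)
  rw [eq_div_iff (mul_ne_zero hβ (sub_ne_zero.mpr hμ)), ← hconst t]
  linarith

lemma false_of_constant_oscillator (hN : 0 < N)
    (hx : ∀ i t, HasDerivAt (x i)
      (y i t - x i t * ((x i t) ^ 2 / 3 - (φ + β * μ i)) + (x i t) ^ 2 / 2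
        - (ε / (N : ℝ)) * ∑ k : Fin N, (x i t - x k t)) t)
    (hy : ∀ i t, HasDerivAt (y i) (-(x i t) + A * Real.sin (ω * t)) t)
    (hA : A ≠ 0) (hω : ω ≠ 0) {i : Fin N} {x₀ : ℝ} (hi : ∀ t, x i t = x₀) : False := by
  have hN0 : (N : ℝ) ≠ 0 := by positivity
  have hcoupling : ∀ k t,
      ε / N * ∑ k' : Fin N, (x k t - x k' t) = ε * x k t - ε / N * ∑ k', x k' t := by
    intro k t
    rw [Finset.sum_sub_distrib, Finset.sum_const, Finset.card_univ, Fintype.card_fin,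
      nsmul_eq_mul, mul_sub, ← mul_assoc, div_mul_cancel₀ _ hN0]
  obtain ⟨C, hC⟩ : ∃ C, ∀ t, ε / N * ∑ k, x k t = -y i t + C := by
    refine ⟨ε * x₀ + x₀ * (x₀ ^ 2 / 3 - (φ + β * μ i)) - x₀ ^ 2 / 2, fun t => ?_⟩
    have h := hx i t
    rw [hcoupling, hi t, show x i = fun _ => x₀ from funext hi] at h
    linarith [h.unique (hasDerivAt_const t x₀)]
  let l : Fin N → ℝ := fun k => φ + β * μ k - ε
  let v : Fin N → ℝ → ℝ := fun k t => x k t - 1 / 2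
  let z : Fin N → ℝ → ℝ := fun k t => 3 * (y k t - y i t + C + 1 / 12 + l k / 2)
  have hv : ∀ k t, HasDerivAt (v k)
      (1 / 3 * (z k t - v k t ^ 3 + 3 * (1 / 4 + l k) * v k t)) t := by
    intro k t
    refine ((hx k t).sub_const (1 / 2)).congr_deriv ?_
    rw [hcoupling, hC t]
    simp only [v, z, l]
    ring
  have hz : ∀ k t, HasDerivAt (z k) (1 / 3 * (9 * (x₀ - 1 / 2) - 9 * v k t)) t := by
    intro k t
    refine ((((((hy k t).sub (hy i t)).add_const C).add_const (1 / 12)).add_const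
      (l k / 2)).const_mul 3).congr_deriv ?_
    simp only [v, hi t]
    ring
  have hrel : ∀ t, A * Real.sin (ω * t) =
      x₀ - ε / (3 * N) * ∑ k, (z k t - v k t ^ 3 + 3 * (1 / 4 + l k) * v k t) := by
    intro t
    have h1 : HasDerivAt (fun t => ε / N * ∑ k, (v k t + 1 / 2)) _ t :=
      (HasDerivAt.fun_sum fun k _ => (hv k t).add_const (1 / 2)).const_mul (ε / N)
    simp only [v, sub_add_cancel] at h1
    rw [funext hC] at h1
    have h2 := h1.unique ((hy i t).neg.add_const C)
    rw [← Finset.mul_sum, hi t] at h2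
    rw [show ε / (3 * N) = ε / N * (1 / 3) by ring]
    simp only [v]
    linarith
  have hexp : ∀ (u : ℂ) (t : ℝ),
      HasDerivAt (fun t : ℝ => Complex.exp (u * t)) (u * Complex.exp (u * t)) t := by
    intro u t
    refine ((Complex.ofRealCLM.hasDerivAt.const_mul u).cexp).congr_deriv ?_
    simp [mul_comm]
  have hA' : (A : ℂ) ≠ 0 := Complex.ofReal_ne_zero.mpr hA
  have hω' : (ω : ℂ) ≠ 0 := Complex.ofReal_ne_zero.mpr hω
  refine false_of_lienard_orbit (v := fun k t => (v k t : ℂ)) (z := fun k t => (z k t : ℂ))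
    (e := fun t => Complex.exp (ω * Complex.I * t))
    (e' := fun t => Complex.exp (-(ω * Complex.I) * t))
    (Λ := fun k => ((3 * (1 / 4 + l k) : ℝ) : ℂ)) (s := 1 / 3) (κ := 9)
    (ξ := ((9 * (x₀ - 1 / 2) : ℝ) : ℂ)) (c := 3 * (ω * Complex.I))
    (a := 2 * Complex.I / A * x₀) (b := -(2 * Complex.I / A * (ε / (3 * N))))
    (by norm_num) (by norm_num) (by simp [hω'])
    (fun k t => (hv k t).ofReal_comp.congr_deriv (by push_cast; rfl))
    (fun k t => (hz k t).ofReal_comp.congr_deriv (by push_cast; rfl))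
    (fun t => (hexp _ t).congr_deriv (by ring))
    (fun t => (hexp _ t).congr_deriv (by ring))
    (fun t => by rw [← Complex.exp_add]; simp) (fun t => ?_)
  have h := congrArg (fun r : ℝ => (r : ℂ)) (hrel t)
  have hsin : Complex.exp (ω * Complex.I * t) - Complex.exp (-(ω * Complex.I) * t) =
      2 * Complex.I / A * (A * Complex.sin (ω * t)) := by
    rw [Complex.sin, show (ω : ℂ) * Complex.I * t = ω * t * Complex.I by ring,
      show -((ω : ℂ) * Complex.I) * t = -(ω * t) * Complex.I by ring]
    field_simp
    rw [Complex.I_sq]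
    ring
  push_cast at h ⊢
  rw [hsin, h]
  ring

end reduction

end VanDerPolNetwork

/-- For the periodically forced heterogeneous network of modified
van der Pol oscillators
  dxᵢ/dt = yᵢ − xᵢ(xᵢ²/3 − (φ + βμᵢ)) + xᵢ²/2 − (ε/N)·∑ₖ (xᵢ − xₖ),
  dyᵢ/dt = −xᵢ + A·sin(ωt),
with β ≠ 0, A ≠ 0, ω ≠ 0: if two oscillators satisfy xᵢ(t) = xⱼ(t) for all t ∈ ℝ,
then μᵢ = μⱼ. -/
theorem stmt_0 (N : ℕ) (hN : 0 < N) (φ β ε A ω : ℝ) (μ : Fin N → ℝ)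
    (x y : Fin N → ℝ → ℝ)
    (hx : ∀ i t, HasDerivAt (x i)
      (y i t - x i t * ((x i t) ^ 2 / 3 - (φ + β * μ i)) + (x i t) ^ 2 / 2
        - (ε / (N : ℝ)) * ∑ k : Fin N, (x i t - x k t)) t)
    (hy : ∀ i t, HasDerivAt (y i) (-(x i t) + A * Real.sin (ω * t)) t)
    (hβ : β ≠ 0) (hA : A ≠ 0) (hω : ω ≠ 0)
    (i j : Fin N) (hij : ∀ t : ℝ, x i t = x j t) :
    μ i = μ j := by
  by_contra hμ
  obtain ⟨x₀, hx₀⟩ := VanDerPolNetwork.exists_const_of_synchronised hx hy hβ hij hμ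
  exact VanDerPolNetwork.false_of_constant_oscillator hN hx hy hA hω hx₀
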